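/- arXiv:2412.00059 — 2 statements merged into one kernel-verified Lean document; each statement's English description precedes it below -/
import Mathlib

section
/- Let f : ℝⁿ → ℝ have a gradient ∇f that is differentiable on an open convex set D ⊆ ℝⁿ, let x* ∈ D satisfy ∇f(x*) = 0, with ∇²f continuous at x* and ∇²f(x*) nonsingular. Let {x_k} ⊆ D be a sequence with x_k → x*, x_k ≠ x* and x_{k+1} ≠ x_k for all k, and let {A_k} be invertible n×n matrices such that A_k (x_{k+1} − x_k) = −∇f(x_k) for all k. If lim_{k→∞} ‖(A_k − ∇²f(x*))(x_{k+1} − x_k)‖ / ‖x_{k+1} − x_k‖ = 0, then {x_k} converges superlinearly to x*: lim_{k→∞} ‖x_{k+1} − x*‖ / ‖x_k − x*‖ = 0. -/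
open scoped RealInnerProductSpace

open Asymptotics

/-- If `u = o(‖u‖ + ‖e‖)`, then the `u` on the right can be absorbed: `u = o(e)`. -/
theorem isLittleO_of_isLittleO_norm_add_norm {α E F : Type*} [NormedAddCommGroup E]
    [NormedAddCommGroup F] {l : Filter α} {u : α → E} {e : α → F}
    (h : u =o[l] fun a => ‖u a‖ + ‖e a‖) : u =o[l] e := by
  rw [isLittleO_iff]
  intro c hc
  have hε : 0 < min (1 / 2) (c / 2) := by positivity
  filter_upwards [isLittleO_iff.1 h hε] with a ha
  rw [Real.norm_of_nonneg (by positivity)] at ha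
  have h₁ : min (1 / 2) (c / 2) * ‖u a‖ ≤ 1 / 2 * ‖u a‖ := by
    gcongr
    exact min_le_left _ _
  have h₂ : min (1 / 2) (c / 2) * ‖e a‖ ≤ c / 2 * ‖e a‖ := by
    gcongr
    exact min_le_right _ _
  linarith

theorem stmt5 {n : ℕ} (f : EuclideanSpace ℝ (Fin n) → ℝ)
    (Hf : EuclideanSpace ℝ (Fin n) → Matrix (Fin n) (Fin n) ℝ)
    (D : Set (EuclideanSpace ℝ (Fin n))) (hD : IsOpen D) (hDconv : Convex ℝ D)
    (hgrad : ∀ y ∈ D, HasFDerivAt (gradient f)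
      (LinearMap.toContinuousLinearMap (Matrix.toEuclideanLin (Hf y))) y)
    (xstar : EuclideanSpace ℝ (Fin n)) (hxstarD : xstar ∈ D)
    (hstat : gradient f xstar = 0)
    (hHcont : ContinuousAt Hf xstar)
    (hHns : IsUnit (Hf xstar))
    (x : ℕ → EuclideanSpace ℝ (Fin n)) (hxD : ∀ k, x k ∈ D)
    (hlim : Filter.Tendsto x Filter.atTop (nhds xstar))
    (hxne : ∀ k, x k ≠ xstar) (hstep : ∀ k, x (k + 1) ≠ x k)
    (A : ℕ → Matrix (Fin n) (Fin n) ℝ) (hA : ∀ k, IsUnit (A k))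
    (hAeq : ∀ k, Matrix.toEuclideanLin (A k) (x (k + 1) - x k) = -(gradient f (x k)))
    (hDM : Filter.Tendsto
      (fun k => ‖Matrix.toEuclideanLin (A k - Hf xstar) (x (k + 1) - x k)‖ /
        ‖x (k + 1) - x k‖) Filter.atTop (nhds 0)) :
    Filter.Tendsto (fun k => ‖x (k + 1) - xstar‖ / ‖x k - xstar‖)
      Filter.atTop (nhds 0) := by
  set T := LinearMap.toContinuousLinearMap (Matrix.toEuclideanLin (Hf xstar)) with hT
  set S := LinearMap.toContinuousLinearMap (Matrix.toEuclideanLin (Hf xstar)⁻¹) with hS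
  have hST : ∀ v, S (T v) = v := by
    intro v
    have hdet := (Matrix.isUnit_iff_isUnit_det _).1 hHns
    simp [hS, hT, Matrix.toLpLin_apply, Matrix.mulVec_mulVec, Matrix.nonsing_inv_mul _ hdet]
  have hr : (fun k => gradient f (x k) - T (x k - xstar)) =o[Filter.atTop]
      fun k => x k - xstar := by
    have h := (hgrad xstar hxstarD).isLittleO.comp_tendsto hlim
    simpa only [Function.comp_def, hstat, sub_zero] using h
  have hs : (fun k => Matrix.toEuclideanLin (A k - Hf xstar) (x (k + 1) - x k))
      =o[Filter.atTop] fun k => x (k + 1) - x k := by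
    rw [← isLittleO_norm_norm]
    refine (isLittleO_iff_tendsto fun k hk => ?_).2 hDM
    exact absurd (sub_eq_zero.1 (norm_eq_zero.1 hk)) (hstep k)
  have hbound : (fun k => x (k + 1) - x k) =O[Filter.atTop]
      fun k => ‖x (k + 1) - xstar‖ + ‖x k - xstar‖ := by
    refine IsBigO.of_bound 1 (Filter.Eventually.of_forall fun k => ?_)
    rw [Real.norm_of_nonneg (by positivity), one_mul, ← sub_sub_sub_cancel_right _ _ xstar]
    exact norm_sub_le _ _
  have hbound' : (fun k => x k - xstar) =O[Filter.atTop]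
      fun k => ‖x (k + 1) - xstar‖ + ‖x k - xstar‖ := by
    refine IsBigO.of_bound 1 (Filter.Eventually.of_forall fun k => ?_)
    rw [Real.norm_of_nonneg (by positivity), one_mul]
    exact le_add_of_nonneg_left (norm_nonneg _)
  have hsum := (hs.trans_isBigO hbound).add (hr.trans_isBigO hbound')
  have hid : ∀ k, x (k + 1) - xstar =
      -S (Matrix.toEuclideanLin (A k - Hf xstar) (x (k + 1) - x k) +
        (gradient f (x k) - T (x k - xstar))) := by
    intro k
    have h : Matrix.toEuclideanLin (A k - Hf xstar) (x (k + 1) - x k) +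
        (gradient f (x k) - T (x k - xstar)) = -T (x (k + 1) - xstar) := by
      have h' : Matrix.toEuclideanLin (Hf xstar) (x (k + 1) - x k) = T (x (k + 1) - x k) := rfl
      rw [map_sub Matrix.toEuclideanLin, LinearMap.sub_apply, hAeq, h']
      simp only [map_sub]
      abel
    rw [h, map_neg, hST, neg_neg]
  have hu : (fun k => x (k + 1) - xstar) =o[Filter.atTop]
      fun k => ‖x (k + 1) - xstar‖ + ‖x k - xstar‖ :=
    ((S.isBigO_comp _ _).trans_isLittleO hsum).neg_left.congr_left fun k => (hid k).symm
  exact (isLittleO_of_isLittleO_norm_add_norm hu).norm_norm.tendsto_div_nhds_zero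
end

section
/- Let f : ℝⁿ → ℝ have a gradient ∇f that is differentiable on an open convex set D ⊆ ℝⁿ, let x* ∈ D satisfy ∇f(x*) = 0, with ∇²f continuous at x* and ∇²f(x*) nonsingular. Let {x_k} ⊆ D be a sequence with x_k → x*, x_k ≠ x* and x_{k+1} ≠ x_k for all k. If lim_{k→∞} ‖∇f(x_{k+1})‖ / ‖x_{k+1} − x_k‖ = 0, then {x_k} converges superlinearly to x*: lim_{k→∞} ‖x_{k+1} − x*‖ / ‖x_k − x*‖ = 0. -/
open scoped RealInnerProductSpace

theorem stmt6 {n : ℕ} (f : EuclideanSpace ℝ (Fin n) → ℝ)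
    (Hf : EuclideanSpace ℝ (Fin n) → Matrix (Fin n) (Fin n) ℝ)
    (D : Set (EuclideanSpace ℝ (Fin n))) (hD : IsOpen D) (hDconv : Convex ℝ D)
    (hgrad : ∀ y ∈ D, HasFDerivAt (gradient f)
      (LinearMap.toContinuousLinearMap (Matrix.toEuclideanLin (Hf y))) y)
    (xstar : EuclideanSpace ℝ (Fin n)) (hxstarD : xstar ∈ D)
    (hstat : gradient f xstar = 0)
    (hHcont : ContinuousAt Hf xstar)
    (hHns : IsUnit (Hf xstar))
    (x : ℕ → EuclideanSpace ℝ (Fin n)) (hxD : ∀ k, x k ∈ D)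
    (hlim : Filter.Tendsto x Filter.atTop (nhds xstar))
    (hxne : ∀ k, x k ≠ xstar) (hstep : ∀ k, x (k + 1) ≠ x k)
    (hgradlim : Filter.Tendsto
      (fun k => ‖gradient f (x (k + 1))‖ / ‖x (k + 1) - x k‖)
      Filter.atTop (nhds 0)) :
    Filter.Tendsto (fun k => ‖x (k + 1) - xstar‖ / ‖x k - xstar‖)
      Filter.atTop (nhds 0) := by
  have hinj : Function.Injective (Matrix.toEuclideanLin (Hf xstar)) := by
    intro u v huv
    have h := congrArg WithLp.ofLp huv
    simp only [Matrix.ofLp_toLpLin, Matrix.toLin'_apply] at h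
    exact WithLp.ofLp_injective 2 (Matrix.mulVec_injective_of_isUnit hHns h)
  have hind : Topology.IsInducing
      (LinearMap.toContinuousLinearMap (Matrix.toEuclideanLin (Hf xstar))) :=
    (LinearMap.isClosedEmbedding_of_injective (LinearMap.ker_eq_bot.mpr hinj)).isInducing
  have hbig := ((hgrad xstar hxstarD).isTheta_sub hind).isBigO_symm
  simp only [hstat, sub_zero] at hbig
  have herr := hbig.comp_tendsto (hlim.comp (Filter.tendsto_add_atTop_nat 1))
  have hsmall : (fun k => gradient f (x (k + 1))) =o[Filter.atTop]
      (fun k => x (k + 1) - x k) := by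
    rw [← Asymptotics.isLittleO_norm_norm]
    refine (Asymptotics.isLittleO_iff_tendsto fun k hk => ?_).mpr hgradlim
    exact absurd (norm_eq_zero.mp hk) (sub_ne_zero.mpr (hstep k))
  have hstep_small : (fun k => x (k + 1) - xstar) =o[Filter.atTop]
      (fun k => x (k + 1) - x k) := herr.trans_isLittleO hsmall
  have hcmp : (fun k => x (k + 1) - x k) =O[Filter.atTop] (fun k => x k - xstar) := by
    refine hstep_small.right_isBigO_sub.trans (Asymptotics.IsBigO.of_bound 1 ?_)
    refine Filter.Eventually.of_forall fun k => ?_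
    rw [one_mul, sub_sub_sub_cancel_left, norm_sub_rev]
  exact (hstep_small.trans_isBigO hcmp).norm_norm.tendsto_div_nhds_zero
end
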